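/- arXiv:1902.05193 — 2 statements merged into one kernel-verified Lean document; each statement's English description precedes it below -/
import Mathlib

section
/- If p and q are acyclic MLL proof nets and p ⇒m q (parallel elimination of a family of multiplicative cuts), then size(p) ≤ 2·size(q). -/
/- Formalization of untyped MLL proof nets with jumps, switching paths,
   and parallel cut elimination, following Chouquet & Vaux Auclair. -/

namespace MLLNets

attribute [local instance] Classical.propDecidable

/-- Trees of MLL nets: variables (axiom conclusions, paired by the involution
    `(n,b) ↦ (n,!b)`), labelled units `1_λ`, labelled counits `⊥_μ`, and
    n-ary connectives `⊗`, `⅋`. -/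
inductive Tree : Type where
  | var : ℕ → Bool → Tree
  | unit : ℕ → Tree
  | counit : ℕ → Tree
  | tens : List Tree → Tree
  | parr : List Tree → Tree

instance : Inhabited Tree := ⟨Tree.unit 0⟩

/-- Atoms: variables, unit labels, counit labels. -/
inductive Atom : Type where
  | var : ℕ → Bool → Atom
  | unit : ℕ → Atom
  | counit : ℕ → Atom

namespace Tree

/-- Number of subtrees of a tree. -/
def size : Tree → ℕ
  | var _ _ => 1
  | unit _ => 1
  | counit _ => 1
  | tens ts => 1 + (ts.attach.map (fun x => x.1.size)).sum
  | parr ts => 1 + (ts.attach.map (fun x => x.1.size)).sum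
termination_by t => sizeOf t
decreasing_by all_goals (have h := List.sizeOf_lt_of_mem x.2; simp; omega)

/-- The set of subtrees of a tree. -/
noncomputable def ST : Tree → Finset Tree
  | var n b => {var n b}
  | unit l => {unit l}
  | counit l => {counit l}
  | tens ts => insert (tens ts) ((ts.attach.map (fun x => x.1.ST)).foldr (· ∪ ·) ∅)
  | parr ts => insert (parr ts) ((ts.attach.map (fun x => x.1.ST)).foldr (· ∪ ·) ∅)
termination_by t => sizeOf t
decreasing_by all_goals (have h := List.sizeOf_lt_of_mem x.2; simp; omega)

/-- The multiset of atoms occurring in a tree. -/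
def atoms : Tree → Multiset Atom
  | var n b => {Atom.var n b}
  | unit l => {Atom.unit l}
  | counit l => {Atom.counit l}
  | tens ts => (ts.attach.map (fun x => x.1.atoms)).sum
  | parr ts => (ts.attach.map (fun x => x.1.atoms)).sum
termination_by t => sizeOf t
decreasing_by all_goals (have h := List.sizeOf_lt_of_mem x.2; simp; omega)

/-- Substitution of the tree `s` for the variable `(n, b)`. -/
def subst (n : ℕ) (b : Bool) (s : Tree) : Tree → Tree
  | var m c => if m = n ∧ c = b then s else var m c
  | unit l => unit l
  | counit l => counit l
  | tens ts => tens (ts.attach.map (fun x => Tree.subst n b s x.1))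
  | parr ts => parr (ts.attach.map (fun x => Tree.subst n b s x.1))
termination_by t => sizeOf t
decreasing_by all_goals (have h := List.sizeOf_lt_of_mem x.2; simp; omega)

/-- Iterated substitution `t[t₁/x̄₁]⋯[tₙ/x̄ₙ]`: each list entry `((n,b), s)`
    records an axiom cut `⟨x|s⟩` with `x = (n,b)`, and `s` is substituted
    for `x̄ = (n, !b)`. -/
def substList (l : List ((ℕ × Bool) × Tree)) (t : Tree) : Tree :=
  l.foldl (fun u e => u.subst e.1.1 (!e.1.2) e.2) t

end Tree

/-- A (bare) proof net with a jump function: a finite set of cuts, a finite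
    family of conclusion trees, and a jump function assigning a tree to each
    counit label. -/
structure Net : Type where
  cuts : Finset (Tree × Tree)
  concl : List Tree
  jump : ℕ → Tree

namespace Net

/-- The subtrees of a net. -/
noncomputable def ST (p : Net) : Finset Tree :=
  (p.cuts.biUnion fun c => c.1.ST ∪ c.2.ST) ∪ (p.concl.map Tree.ST).foldr (· ∪ ·) ∅

/-- The multiset of atoms of a net. -/
def atoms (p : Net) : Multiset Atom :=
  (p.cuts.val.map fun c => c.1.atoms + c.2.atoms).sum + (p.concl.map Tree.atoms).sum

/-- The counit labels occurring in a net. -/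
noncomputable def counitLabels (p : Net) : Finset ℕ :=
  p.ST.biUnion fun t => match t with | Tree.counit l => {l} | _ => ∅

/-- The size of a net: its number of subtrees. -/
def size (p : Net) : ℕ :=
  (p.cuts.sum fun c => c.1.size + c.2.size) + (p.concl.map Tree.size).sum

/-- Well-formedness: each atom occurs at most once, connectives have arity
    ≥ 1, variables are closed under the involution, and jumps of counits
    occurring in the net are subtrees of the net. -/
def IsMLL (p : Net) : Prop :=
  p.atoms.Nodup ∧
  (∀ ts, Tree.tens ts ∈ p.ST → ts ≠ []) ∧
  (∀ ts, Tree.parr ts ∈ p.ST → ts ≠ []) ∧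
  (∀ n b, Atom.var n b ∈ p.atoms → Atom.var n (!b) ∈ p.atoms) ∧
  (∀ m, Tree.counit m ∈ p.ST → p.jump m ∈ p.ST)

end Net

/-- Edges of switching graphs: axiom edges, ⊗-edges (one per premise),
    ⅋-edges (one per ⅋-tree, its other endpoint chosen by the switching),
    jump edges and cut edges. -/
inductive Edge : Type where
  | ax : ℕ → Edge
  | tensE : Tree → Tree → Edge
  | parrE : Tree → Edge
  | jumpE : ℕ → Edge
  | cutE : Tree → Tree → Edge

/-- A switching chooses a premise of each ⅋-subtree. -/
def Net.IsSwitching (p : Net) (I : Tree → Tree) : Prop :=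
  ∀ ts, Tree.parr ts ∈ p.ST → I (Tree.parr ts) ∈ ts

/-- Adjacency in the switching graph of `p` determined by the switching `I`. -/
inductive Net.Adj (p : Net) (I : Tree → Tree) : Edge → Tree → Tree → Prop
  | ax (n : ℕ) : Tree.var n true ∈ p.ST → Tree.var n false ∈ p.ST →
      Net.Adj p I (Edge.ax n) (Tree.var n true) (Tree.var n false)
  | tens {ts t} : Tree.tens ts ∈ p.ST → t ∈ ts →
      Net.Adj p I (Edge.tensE (Tree.tens ts) t) (Tree.tens ts) t
  | parr {ts} : Tree.parr ts ∈ p.ST →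
      Net.Adj p I (Edge.parrE (Tree.parr ts)) (Tree.parr ts) (I (Tree.parr ts))
  | jump {m} : Tree.counit m ∈ p.ST →
      Net.Adj p I (Edge.jumpE m) (Tree.counit m) (p.jump m)
  | cut {t s} : (t, s) ∈ p.cuts → Net.Adj p I (Edge.cutE t s) t s
  | symm {e t u} : Net.Adj p I e t u → Net.Adj p I e u t

/-- `IsTrail p I t l` : `l` is a switching path (a sequence of pairwise
    distinct consecutive edges, each paired with the vertex it reaches)
    starting from the subtree `t`. -/
inductive Net.IsTrail (p : Net) (I : Tree → Tree) : Tree → List (Edge × Tree) → Prop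
  | nil (t) : t ∈ p.ST → Net.IsTrail p I t []
  | cons {t e u l} : Net.Adj p I e t u → Net.IsTrail p I u l → (∀ x ∈ l, x.1 ≠ e) →
      Net.IsTrail p I t ((e, u) :: l)

/-- `ln p` : the maximal length of a switching path of `p`. -/
noncomputable def Net.ln (p : Net) : ℕ :=
  sSup {n | ∃ I t l, p.IsSwitching I ∧ p.IsTrail I t l ∧ l.length = n}

/-- `jd p` : the maximal number of counit labels jumping to a common
    subtree of `p`. -/
noncomputable def Net.jd (p : Net) : ℕ :=
  p.ST.sup fun t => (p.counitLabels.filter fun m => p.jump m = t).card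

/-- A net is acyclic when no switching path visits the same subtree twice. -/
def Net.IsAcyclic (p : Net) : Prop :=
  ∀ I, p.IsSwitching I → ∀ t l, p.IsTrail I t l → (t :: l.map Prod.snd).Nodup

/-! ### Parallel cut elimination -/

/-- Cuts of `p` eliminated by the multiplicative family `F` (given by the
    lists of premises of the ⊗- and ⅋-trees of each cut). -/
noncomputable def melim (F : Finset (List Tree × List Tree)) : Finset (Tree × Tree) :=
  F.biUnion fun c => {(Tree.tens c.1, Tree.parr c.2), (Tree.parr c.2, Tree.tens c.1)}

/-- Residual cuts produced by the multiplicative family `F`. -/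
noncomputable def mres (F : Finset (List Tree × List Tree)) : Finset (Tree × Tree) :=
  F.biUnion fun c => (c.1.zip c.2).toFinset

/-- Cuts of `p` eliminated by an axiom family. -/
noncomputable def aelim (la : List ((ℕ × Bool) × Tree)) : Finset (Tree × Tree) :=
  la.foldr (fun e s =>
    insert (Tree.var e.1.1 e.1.2, e.2) (insert (e.2, Tree.var e.1.1 e.1.2) s)) ∅

/-- Cuts of `p` eliminated by an evanescent family (pairs `(λ, μ)` of a unit
    and a counit label). -/
noncomputable def eelim (le : List (ℕ × ℕ)) : Finset (Tree × Tree) :=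
  le.foldr (fun e s =>
    insert (Tree.unit e.1, Tree.counit e.2) (insert (Tree.counit e.2, Tree.unit e.1) s)) ∅

/-- The redirection function `ρ` for the parallel elimination of evanescent
    cuts: `Rho p le j t` holds when the jump of the `j`-th eliminated
    counit, followed along the chain of eliminated evanescent cuts, ends
    at the tree `t`. -/
inductive Rho (p : Net) (le : List (ℕ × ℕ)) : ℕ → Tree → Prop
  | base (j : ℕ) :
      (∀ i < j, p.jump ((le.getD j (0,0)).2) ≠ Tree.counit ((le.getD i (0,0)).2) ∧
                p.jump ((le.getD j (0,0)).2) ≠ Tree.unit ((le.getD i (0,0)).1)) →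
      Rho p le j (p.jump ((le.getD j (0,0)).2))
  | step {i j : ℕ} {t : Tree} : i < j →
      (p.jump ((le.getD j (0,0)).2) = Tree.counit ((le.getD i (0,0)).2) ∨
       p.jump ((le.getD j (0,0)).2) = Tree.unit ((le.getD i (0,0)).1)) →
      Rho p le i t → Rho p le j t

/-- `ParStepF p q F la le` : `q` is obtained from `p` by the simultaneous
    elimination of the family `F` of multiplicative cuts, the family `la` of
    axiom cuts and the family `le` of evanescent cuts. -/
structure ParStepF (p q : Net) (F : Finset (List Tree × List Tree))
    (la : List ((ℕ × Bool) × Tree)) (le : List (ℕ × ℕ)) : Prop where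
  /-- each member of `F` is a multiplicative cut of `p` -/
  hF : ∀ c ∈ F, c.1.length = c.2.length ∧ c.1 ≠ [] ∧
       ((Tree.tens c.1, Tree.parr c.2) ∈ p.cuts ∨ (Tree.parr c.2, Tree.tens c.1) ∈ p.cuts)
  /-- each member of `la` is an axiom cut of `p` -/
  ha : ∀ e ∈ la, (Tree.var e.1.1 e.1.2, e.2) ∈ p.cuts ∨ (e.2, Tree.var e.1.1 e.1.2) ∈ p.cuts
  haN : (la.map Prod.fst).Nodup
  /-- `x̄ᵢ ∉ {x₁, …, xₙ}` -/
  haBar : ∀ e ∈ la, (e.1.1, !e.1.2) ∉ la.map Prod.fst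
  /-- `x̄ᵢ` does not occur in `tⱼ` for `i ≤ j` -/
  haFv : ∀ i j, i ≤ j → j < la.length →
      Atom.var (la.getD i default).1.1 (!(la.getD i default).1.2) ∉ (la.getD j default).2.atoms
  /-- each member of `le` is a cut of `p` between a unit and a counit -/
  he : ∀ e ∈ le, (Tree.unit e.1, Tree.counit e.2) ∈ p.cuts ∨ (Tree.counit e.2, Tree.unit e.1) ∈ p.cuts
  heN : (le.map Prod.snd).Nodup
  /-- `jump(μᵢ) ∉ {⊥_{μⱼ}, 1_{λⱼ}}` for `i ≤ j` (in particular each eliminated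
      evanescent cut is reducible) -/
  heJ : ∀ i j, i ≤ j → j < le.length →
      p.jump ((le.getD i (0,0)).2) ≠ Tree.counit ((le.getD j (0,0)).2) ∧
      p.jump ((le.getD i (0,0)).2) ≠ Tree.unit ((le.getD j (0,0)).1)
  /-- the cuts of `q`: the remaining cuts plus the multiplicative residuals,
      under the substitution generated by the axiom cuts -/
  hcuts : q.cuts = ((p.cuts \ (melim F ∪ aelim la ∪ eelim le)) ∪ mres F).image
      (fun c => (Tree.substList la c.1, Tree.substList la c.2))
  /-- the conclusions of `q` -/
  hconcl : q.concl = p.concl.map (Tree.substList la)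
  /-- the jump function of `q`, with redirections -/
  hjump : ∀ m, Tree.counit m ∈ q.ST →
      (∃ c ∈ F, p.jump m = Tree.tens c.1 ∧ q.jump m = Tree.substList la c.1.headI) ∨
      (∃ c ∈ F, p.jump m = Tree.parr c.2 ∧ q.jump m = Tree.substList la c.2.headI) ∨
      (∃ i < la.length,
        (p.jump m = Tree.var (la.getD i default).1.1 (la.getD i default).1.2 ∨
         p.jump m = Tree.var (la.getD i default).1.1 (!(la.getD i default).1.2)) ∧
        q.jump m = Tree.substList (la.drop (i+1)) (la.getD i default).2) ∨
      (∃ i < le.length,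
        (p.jump m = Tree.counit ((le.getD i (0,0)).2) ∨
         p.jump m = Tree.unit ((le.getD i (0,0)).1)) ∧
        ∃ t, Rho p le i t ∧ q.jump m = Tree.substList la t) ∨
      ((∀ c ∈ F, p.jump m ≠ Tree.tens c.1 ∧ p.jump m ≠ Tree.parr c.2) ∧
       (∀ e ∈ la, p.jump m ≠ Tree.var e.1.1 e.1.2 ∧ p.jump m ≠ Tree.var e.1.1 (!e.1.2)) ∧
       (∀ e ∈ le, p.jump m ≠ Tree.counit e.2 ∧ p.jump m ≠ Tree.unit e.1) ∧
       q.jump m = Tree.substList la (p.jump m))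

/-- Parallel elimination of a family of multiplicative cuts (`p ⇒m q`). -/
def MultStep (p q : Net) : Prop := ∃ F, ParStepF p q F [] []

/-- Parallel elimination of a family of axiom cuts (`p ⇒a q`). -/
def AxStep (p q : Net) : Prop := ∃ la, ParStepF p q ∅ la []

/-- Parallel elimination of a family of evanescent cuts (`p ⇒e q`). -/
def EvStep (p q : Net) : Prop := ∃ le, ParStepF p q ∅ [] le

/-- A parallel cut elimination step (`p ⇒ q`), eliminating an arbitrary
    family of reducible cuts of the three kinds. -/
def ParStep (p q : Net) : Prop := ∃ F la le, ParStepF p q F la le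

/-- Elimination of a single reducible cut. -/
def Step1 (p q : Net) : Prop :=
  (∃ c, ParStepF p q {c} [] []) ∨ (∃ e, ParStepF p q ∅ [e] []) ∨ (∃ e, ParStepF p q ∅ [] [e])

/-- `k` parallel cut elimination steps. -/
def ParStepN : ℕ → Net → Net → Prop
  | 0, p, q => p = q
  | k+1, p, q => ∃ r, ParStep p r ∧ ParStepN k r q

/-! ### Evanescent cuts and the sets `Iⁿ(t)` -/

/-- `p.IsEvCut l m` : `⟨1_l | ⊥_m⟩` is a reducible evanescent cut of `p`. -/
def Net.IsEvCut (p : Net) (l m : ℕ) : Prop :=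
  ((Tree.unit l, Tree.counit m) ∈ p.cuts ∨ (Tree.counit m, Tree.unit l) ∈ p.cuts) ∧
  p.jump m ≠ Tree.unit l ∧ p.jump m ≠ Tree.counit m

/-- The sets `Iⁿ(t)` of counit labels reaching `t` through a chain of `n`
    evanescent cuts. -/
noncomputable def Net.Iset (p : Net) (t : Tree) : ℕ → Finset ℕ
  | 0 => p.counitLabels.filter fun m => p.jump m = t
  | n+1 => p.counitLabels.filter fun m' =>
      ∃ l m, p.IsEvCut l m ∧ m ∈ p.Iset t n ∧
        (p.jump m' = Tree.counit m ∨ p.jump m' = Tree.unit l)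

/-- The number of evanescent cuts of `p`. -/
noncomputable def Net.evCutCount (p : Net) : ℕ :=
  (p.cuts.filter fun c => ∃ l m,
    (c = (Tree.unit l, Tree.counit m) ∨ c = (Tree.counit m, Tree.unit l)) ∧
    p.jump m ≠ Tree.unit l ∧ p.jump m ≠ Tree.counit m).card

/-! ### The function φ -/

/-- `φ(0) = 0` and `φ(n) = n + (n+1)(φ(n-1)+2)` for `n > 0`. -/
def phi : ℕ → ℕ
  | 0 => 0
  | n + 1 => (n + 1) + (n + 2) * (phi n + 2)

/-! ### Residual edges, slipknots, bridges and bounces -/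

/-- The residual cut edges in `q` of an eliminated multiplicative cut. -/
noncomputable def resEdges (c : List Tree × List Tree) : Finset Edge :=
  ((c.1.zip c.2).map fun d => Edge.cutE d.1 d.2).toFinset

/-- Canonical form of a `c`-bridge: a path bound to `c` crossing its cut edge. -/
def IsBridgeCan (c : List Tree × List Tree) (b : List Edge) : Prop :=
  ∃ pre post : List Edge,
    (pre = [] ∨ ∃ t ∈ c.1, pre = [Edge.tensE (Tree.tens c.1) t]) ∧
    (post = [] ∨ post = [Edge.parrE (Tree.parr c.2)]) ∧
    (b = pre ++ Edge.cutE (Tree.tens c.1) (Tree.parr c.2) :: post ∨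
     b = pre ++ Edge.cutE (Tree.parr c.2) (Tree.tens c.1) :: post)

/-- A `c`-bridge, in either direction. -/
def IsBridge (c : List Tree × List Tree) (b : List Edge) : Prop :=
  IsBridgeCan c b ∨ IsBridgeCan c b.reverse

/-- A `c`-bounce: a path bound to `c`, not crossing its cut edge, and
    visiting its ⊗-tree. -/
def IsBounce (c : List Tree × List Tree) (b : List Edge) : Prop :=
  b = [] ∨ (∃ t ∈ c.1, b = [Edge.tensE (Tree.tens c.1) t]) ∨
  (∃ t ∈ c.1, ∃ t' ∈ c.1, t ≠ t' ∧
    b = [Edge.tensE (Tree.tens c.1) t, Edge.tensE (Tree.tens c.1) t'])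

/-- `Gen F es es'` : the edge sequence `es'` (in `p`) is generated by the
    straight edge sequence `es` (in `q`): preserved edges are kept, and each
    residual cut edge is replaced by a bridge of the corresponding
    eliminated cut. -/
inductive Gen (F : Finset (List Tree × List Tree)) : List Edge → List Edge → Prop
  | nil : Gen F [] []
  | pres {e l l'} : (∀ c ∈ F, e ∉ resEdges c) → Gen F l l' → Gen F (e :: l) (e :: l')
  | res {c d l l' b} : c ∈ F → d ∈ resEdges c → IsBridge c b → Gen F l l' →
      Gen F (d :: l) (b ++ l')

/-- A straight path: a path with no slipknot, i.e. crossing at most one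
    residual of each eliminated cut. -/
def Straight (F : Finset (List Tree × List Tree)) (l : List (Edge × Tree)) : Prop :=
  ¬ ∃ c ∈ F, ∃ l₁ l₂ l₃ : List (Edge × Tree), ∃ d v d' v',
      d ∈ resEdges c ∧ d' ∈ resEdges c ∧ l = l₁ ++ (d, v) :: l₂ ++ (d', v') :: l₃

/-- Independent paths: disjoint, and crossing residuals of no common
    eliminated cut. -/
def Indep (F : Finset (List Tree × List Tree)) (l₁ l₂ : List (Edge × Tree)) : Prop :=
  (∀ x ∈ l₁, ∀ y ∈ l₂, x.1 ≠ y.1) ∧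
  ¬ ∃ c ∈ F, (∃ x ∈ l₁, x.1 ∈ resEdges c) ∧ (∃ y ∈ l₂, y.1 ∈ resEdges c)

/-- `DecompWith F l cs χs ξs` : the decomposition `l = χ₁ξ₁⋯χₙξₙχₙ₊₁` of a
    path of `q` into pairwise independent straight paths `χᵢ` and slipknots
    `ξᵢ` on the pairwise distinct eliminated cuts `cs = c₁, …, cₙ`. -/
def DecompWith (F : Finset (List Tree × List Tree)) (l : List (Edge × Tree))
    (cs : List (List Tree × List Tree)) (χs ξs : List (List (Edge × Tree))) : Prop :=
  cs.Nodup ∧ (∀ c ∈ cs, c ∈ F) ∧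
  χs.length = cs.length + 1 ∧ ξs.length = cs.length ∧
  l = (List.zipWith (· ++ ·) χs (ξs ++ [[]])).flatten ∧
  (∀ x ∈ χs, Straight F x ∧ ∀ c ∈ cs, ∀ y ∈ x, y.1 ∉ resEdges c) ∧
  χs.Pairwise (Indep F) ∧
  List.Forall₂ (fun (ξ : List (Edge × Tree)) (c : List Tree × List Tree) =>
      ∃ t s t' s' mid, (t, s) ∈ c.1.zip c.2 ∧ (t', s') ∈ c.1.zip c.2 ∧ t ≠ t' ∧
        ξ = (Edge.cutE t s, s) :: mid ++ [(Edge.cutE t' s', t')]) ξs cs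

/-- `Decomp F l cs` : some decomposition of `l` along the cut sequence `cs`
    exists. -/
def Decomp (F : Finset (List Tree × List Tree)) (l : List (Edge × Tree))
    (cs : List (List Tree × List Tree)) : Prop :=
  ∃ χs ξs, DecompWith F l cs χs ξs

/-! ### α-equivalence -/

/-- A renaming of atoms: a map on variable names together with a possible
    flip of polarities (so as to commute with the involution), a map on unit
    labels and a map on counit labels. -/
structure Ren : Type where
  v : ℕ → ℕ
  vb : ℕ → Bool
  u : ℕ → ℕ
  c : ℕ → ℕ

/-- Applying a renaming to a tree. -/
def Tree.rename (r : Ren) : Tree → Tree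
  | Tree.var n b => Tree.var (r.v n) (xor b (r.vb n))
  | Tree.unit l => Tree.unit (r.u l)
  | Tree.counit l => Tree.counit (r.c l)
  | Tree.tens ts => Tree.tens (ts.attach.map (fun x => Tree.rename r x.1))
  | Tree.parr ts => Tree.parr (ts.attach.map (fun x => Tree.rename r x.1))
termination_by t => sizeOf t
decreasing_by all_goals (have h := List.sizeOf_lt_of_mem x.2; simp; omega)

/-- α-equivalence of nets: renaming of atoms (preserving the involution on
    variables) and reindexing of cuts. -/
def AlphaEq (p q : Net) : Prop :=
  ∃ r : Ren, Function.Bijective r.v ∧ Function.Bijective r.u ∧ Function.Bijective r.c ∧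
    q.cuts = p.cuts.image (fun c => (c.1.rename r, c.2.rename r)) ∧
    q.concl = p.concl.map (Tree.rename r) ∧
    (∀ m, Tree.counit m ∈ p.ST → q.jump (r.c m) = (p.jump m).rename r)

end MLLNets

namespace MLLNets

attribute [local instance] Classical.propDecidable

namespace Tree

theorem size_tens (ts : List Tree) : (tens ts).size = 1 + (ts.map size).sum := by
  rw [size, List.attach_map_val (f := size)]

theorem size_parr (ts : List Tree) : (parr ts).size = 1 + (ts.map size).sum := by
  rw [size, List.attach_map_val (f := size)]

theorem atoms_tens (ts : List Tree) : (tens ts).atoms = (ts.map atoms).sum := by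
  rw [atoms, List.attach_map_val (f := atoms)]

theorem atoms_parr (ts : List Tree) : (parr ts).atoms = (ts.map atoms).sum := by
  rw [atoms, List.attach_map_val (f := atoms)]

theorem one_le_size (t : Tree) : 1 ≤ t.size := by
  cases t <;> simp [size]

theorem length_le_sum_size (ts : List Tree) : ts.length ≤ (ts.map size).sum := by
  induction ts with
  | nil => simp
  | cons t ts ih =>
    have := one_le_size t
    simp only [List.length_cons, List.map_cons, List.sum_cons]
    omega

theorem mem_ST_self (t : Tree) : t ∈ t.ST := by
  cases t <;> simp [ST]

theorem mem_foldr_union {α β : Type*} {f : α → Finset β} {l : List α} {x : β} :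
    x ∈ (l.map f).foldr (· ∪ ·) ∅ ↔ ∃ a ∈ l, x ∈ f a := by
  induction l with
  | nil => simp
  | cons a l ih => simp [ih]

theorem ST_subset_tens {t : Tree} {ts : List Tree} (h : t ∈ ts) : t.ST ⊆ (tens ts).ST := by
  intro x hx
  rw [ST, List.attach_map_val (f := ST)]
  exact Finset.mem_insert_of_mem (mem_foldr_union.2 ⟨t, h, hx⟩)

theorem ST_subset_parr {t : Tree} {ts : List Tree} (h : t ∈ ts) : t.ST ⊆ (parr ts).ST := by
  intro x hx
  rw [ST, List.attach_map_val (f := ST)]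
  exact Finset.mem_insert_of_mem (mem_foldr_union.2 ⟨t, h, hx⟩)

theorem atoms_le_sum {t : Tree} {ts : List Tree} (h : t ∈ ts) :
    t.atoms ≤ (ts.map atoms).sum :=
  List.single_le_sum (fun _ _ => zero_le) _ (List.mem_map_of_mem h)

/-- A tree whose connectives all have positive arity contains an atom. -/
theorem atoms_ne_zero : ∀ t : Tree, (∀ ts, tens ts ∈ t.ST → ts ≠ []) →
    (∀ ts, parr ts ∈ t.ST → ts ≠ []) → t.atoms ≠ 0
  | var n b, _, _ => by simp [atoms]
  | unit l, _, _ => by simp [atoms]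
  | counit l, _, _ => by simp [atoms]
  | tens [], h, _ => absurd rfl (h [] (mem_ST_self _))
  | parr [], _, h => absurd rfl (h [] (mem_ST_self _))
  | tens (t :: ts), h₁, h₂ => by
    have ht := atoms_ne_zero t
      (fun us hu => h₁ us (ST_subset_tens List.mem_cons_self hu))
      (fun us hu => h₂ us (ST_subset_tens List.mem_cons_self hu))
    rw [atoms_tens, List.map_cons, List.sum_cons]
    exact fun h => ht (add_eq_zero.1 h).1
  | parr (t :: ts), h₁, h₂ => by
    have ht := atoms_ne_zero t
      (fun us hu => h₁ us (ST_subset_parr List.mem_cons_self hu))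
      (fun us hu => h₂ us (ST_subset_parr List.mem_cons_self hu))
    rw [atoms_parr, List.map_cons, List.sum_cons]
    exact fun h => ht (add_eq_zero.1 h).1

end Tree

/-- The number of subtrees of a cut. -/
def cutSize (c : Tree × Tree) : ℕ := c.1.size + c.2.size

/-- The atoms of a cut. -/
def cutAtoms (c : Tree × Tree) : Multiset Atom := c.1.atoms + c.2.atoms

/-- Pairwise disjoint nonempty multisets are pairwise distinct. -/
theorem nodup_of_nodup_sum_map {α β : Type*} {f : α → Multiset β} {l : List α}
    (hl : (l.map f).sum.Nodup) (hf : ∀ x ∈ l, f x ≠ 0) : l.Nodup := by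
  induction l with
  | nil => simp
  | cons a l ih =>
    rw [List.map_cons, List.sum_cons, Multiset.nodup_add] at hl
    refine List.nodup_cons.2 ⟨fun ha => ?_, ih hl.2.1 fun x hx => hf x (List.mem_cons_of_mem _ hx)⟩
    obtain ⟨b, hb⟩ := Multiset.exists_mem_of_ne_zero (hf a List.mem_cons_self)
    have hle : f a ≤ (l.map f).sum :=
      List.single_le_sum (fun _ _ => zero_le) _ (List.mem_map_of_mem ha)
    exact Multiset.disjoint_left.1 hl.2.2 hb (Multiset.mem_of_le hle hb)

namespace Net.IsMLL

variable {p : Net}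

theorem nodup_sum_cutAtoms (hp : p.IsMLL) : (∑ c ∈ p.cuts, cutAtoms c).Nodup :=
  (Multiset.nodup_add.1 hp.1).1

theorem nodup_cutAtoms (hp : p.IsMLL) {c : Tree × Tree} (hc : c ∈ p.cuts) : (cutAtoms c).Nodup :=
  Multiset.nodup_of_le (Finset.single_le_sum (fun _ _ => zero_le) hc) hp.nodup_sum_cutAtoms

theorem disjoint_cutAtoms (hp : p.IsMLL) {c d : Tree × Tree} (hc : c ∈ p.cuts) (hd : d ∈ p.cuts)
    (hne : c ≠ d) : Disjoint (cutAtoms c) (cutAtoms d) := by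
  have hsub : ({c, d} : Finset _) ⊆ p.cuts := by
    simp [Finset.insert_subset_iff, hc, hd]
  have hle := Multiset.nodup_of_le
    (Finset.sum_le_sum_of_subset_of_nonneg (f := cutAtoms) hsub fun _ _ _ => zero_le)
    hp.nodup_sum_cutAtoms
  rw [Finset.sum_pair hne] at hle
  exact (Multiset.nodup_add.1 hle).2.2

theorem atoms_ne_zero (hp : p.IsMLL) {t : Tree} (ht : t.ST ⊆ p.ST) : t.atoms ≠ 0 :=
  t.atoms_ne_zero (fun us hu => hp.2.1 us (ht hu)) (fun us hu => hp.2.2.1 us (ht hu))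

end Net.IsMLL

theorem Net.ST_subset_of_mem_cuts {p : Net} {c : Tree × Tree} (hc : c ∈ p.cuts) :
    c.1.ST ∪ c.2.ST ⊆ p.ST :=
  (Finset.subset_biUnion_of_mem (fun c : Tree × Tree => c.1.ST ∪ c.2.ST) hc).trans
    Finset.subset_union_left

/-- The orientation of the cut between `⊗(c.1)` and `⅋(c.2)` occurring in `p`. -/
noncomputable def Net.multCut (p : Net) (c : List Tree × List Tree) : Tree × Tree :=
  if (Tree.tens c.1, Tree.parr c.2) ∈ p.cuts then (Tree.tens c.1, Tree.parr c.2)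
  else (Tree.parr c.2, Tree.tens c.1)

theorem Net.multCut_injective (p : Net) : Function.Injective p.multCut := by
  rintro ⟨a, b⟩ ⟨a', b'⟩ h
  unfold Net.multCut at h
  split_ifs at h <;> simp_all

theorem cutSize_multCut (p : Net) (c : List Tree × List Tree) :
    cutSize (p.multCut c) = 2 + ((c.1.map Tree.size).sum + (c.2.map Tree.size).sum) := by
  unfold Net.multCut cutSize
  split_ifs <;> simp only [Tree.size_tens, Tree.size_parr] <;> omega

theorem cutAtoms_multCut (p : Net) (c : List Tree × List Tree) :
    cutAtoms (p.multCut c) = (c.1.map Tree.atoms).sum + (c.2.map Tree.atoms).sum := by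
  unfold Net.multCut cutAtoms
  split_ifs <;> simp only [Tree.atoms_tens, Tree.atoms_parr, add_comm]

theorem cutAtoms_le_of_mem_zip {p : Net} {c : List Tree × List Tree} {d : Tree × Tree}
    (hd : d ∈ c.1.zip c.2) : cutAtoms d ≤ cutAtoms (p.multCut c) := by
  rw [cutAtoms_multCut]
  obtain ⟨h₁, h₂⟩ := List.of_mem_zip (a := d.1) (b := d.2) hd
  exact add_le_add (Tree.atoms_le_sum h₁) (Tree.atoms_le_sum h₂)

theorem sum_map_zip_cutSize {l₁ l₂ : List Tree} (h : l₁.length = l₂.length) :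
    ((l₁.zip l₂).map cutSize).sum = (l₁.map Tree.size).sum + (l₂.map Tree.size).sum := by
  induction l₁ generalizing l₂ with
  | nil => cases l₂ <;> simp_all
  | cons a l₁ ih =>
    cases l₂ with
    | nil => simp at h
    | cons b l₂ =>
      simp only [List.zip_cons_cons, List.map_cons, List.sum_cons, cutSize,
        ih (Nat.succ_injective h)]
      omega

namespace ParStepF

variable {p q : Net} {F : Finset (List Tree × List Tree)} {c : List Tree × List Tree}

theorem multCut_mem (h : ParStepF p q F [] []) (hc : c ∈ F) : p.multCut c ∈ p.cuts := by
  unfold Net.multCut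
  split_ifs with hm
  · exact hm
  · exact (h.hF c hc).2.2.resolve_left hm

theorem ST_subset_of_mem (h : ParStepF p q F [] []) (hc : c ∈ F) {t : Tree} (ht : t ∈ c.1) :
    t.ST ⊆ p.ST := by
  refine (Tree.ST_subset_tens ht).trans ?_
  rcases (h.hF c hc).2.2 with hm | hm
  · exact Finset.subset_union_left.trans (Net.ST_subset_of_mem_cuts hm)
  · exact Finset.subset_union_right.trans (Net.ST_subset_of_mem_cuts hm)

theorem cuts_eq (h : ParStepF p q F [] []) : q.cuts = (p.cuts \ melim F) ∪ mres F := by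
  rw [h.hcuts]
  simp [aelim, eelim, Tree.substList]

theorem concl_eq (h : ParStepF p q F [] []) : q.concl = p.concl := by
  rw [h.hconcl]
  exact List.map_id p.concl

theorem exists_atom_of_mem_zip (hp : p.IsMLL) (h : ParStepF p q F [] []) (hc : c ∈ F)
    {d : Tree × Tree} (hd : d ∈ c.1.zip c.2) : ∃ a, a ∈ cutAtoms d := by
  obtain ⟨a, ha⟩ := Multiset.exists_mem_of_ne_zero
    (hp.atoms_ne_zero (h.ST_subset_of_mem hc (List.of_mem_zip (a := d.1) (b := d.2) hd).1))
  exact ⟨a, Multiset.mem_add.2 (Or.inl ha)⟩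

theorem nodup_zip (hp : p.IsMLL) (h : ParStepF p q F [] []) (hc : c ∈ F) :
    (c.1.zip c.2).Nodup := by
  have hn := hp.nodup_cutAtoms (h.multCut_mem hc)
  rw [cutAtoms_multCut] at hn
  have h₁ : c.1.Nodup := nodup_of_nodup_sum_map (Multiset.nodup_add.1 hn).1
    fun t ht => hp.atoms_ne_zero (h.ST_subset_of_mem hc ht)
  refine List.Nodup.of_map Prod.fst ?_
  rwa [List.map_fst_zip (h.hF c hc).1.le]

theorem disjoint_mres (hp : p.IsMLL) (h : ParStepF p q F [] []) :
    Disjoint (p.cuts \ melim F) (mres F) := by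
  refine Finset.disjoint_left.2 fun d hd hd' => ?_
  obtain ⟨c, hc, hdc⟩ := Finset.mem_biUnion.1 hd'
  rw [List.mem_toFinset] at hdc
  obtain ⟨hdp, hdm⟩ := Finset.mem_sdiff.1 hd
  have hne : d ≠ p.multCut c := by
    rintro rfl
    refine hdm (Finset.mem_biUnion.2 ⟨c, hc, ?_⟩)
    unfold Net.multCut
    split_ifs <;> simp
  obtain ⟨a, ha⟩ := h.exists_atom_of_mem_zip hp hc hdc
  exact Multiset.disjoint_left.1 (hp.disjoint_cutAtoms hdp (h.multCut_mem hc) hne) ha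
    (Multiset.mem_of_le (cutAtoms_le_of_mem_zip hdc) ha)

theorem pairwiseDisjoint_zip (hp : p.IsMLL) (h : ParStepF p q F [] []) :
    (F : Set (List Tree × List Tree)).PairwiseDisjoint fun c => (c.1.zip c.2).toFinset := by
  intro c hc c' hc' hne
  refine Finset.disjoint_left.2 fun d hd hd' => ?_
  rw [List.mem_toFinset] at hd hd'
  obtain ⟨a, ha⟩ := h.exists_atom_of_mem_zip hp hc hd
  exact Multiset.disjoint_left.1 (hp.disjoint_cutAtoms (h.multCut_mem hc) (h.multCut_mem hc')
    (p.multCut_injective.ne hne)) (Multiset.mem_of_le (cutAtoms_le_of_mem_zip hd) ha)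
    (Multiset.mem_of_le (cutAtoms_le_of_mem_zip hd') ha)

theorem inter_melim_subset (hp : p.IsMLL) (h : ParStepF p q F [] []) :
    p.cuts ∩ melim F ⊆ F.image p.multCut := by
  intro d hd
  obtain ⟨hdp, hdm⟩ := Finset.mem_inter.1 hd
  obtain ⟨c, hc, hdc⟩ := Finset.mem_biUnion.1 hdm
  refine Finset.mem_image.2 ⟨c, hc, ?_⟩
  by_contra hne
  have hdisj := hp.disjoint_cutAtoms (h.multCut_mem hc) hdp hne
  have heq : cutAtoms d = cutAtoms (p.multCut c) := by
    rw [cutAtoms_multCut]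
    simp only [Finset.mem_insert, Finset.mem_singleton] at hdc
    rcases hdc with rfl | rfl <;> simp only [cutAtoms, Tree.atoms_tens, Tree.atoms_parr, add_comm]
  rw [heq, disjoint_self] at hdisj
  obtain ⟨t, ht⟩ := List.exists_mem_of_ne_nil _ (h.hF c hc).2.1
  rw [cutAtoms_multCut] at hdisj
  obtain ⟨a, ha⟩ := Multiset.exists_mem_of_ne_zero
    (hp.atoms_ne_zero (h.ST_subset_of_mem hc ht))
  have := Multiset.mem_add.2 (Or.inl (b := a ∈ (c.2.map Tree.atoms).sum)
    (Multiset.mem_of_le (Tree.atoms_le_sum ht) ha))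
  rw [hdisj] at this
  exact Multiset.notMem_zero _ this

theorem cutSize_multCut_le (hp : p.IsMLL) (h : ParStepF p q F [] []) (hc : c ∈ F) :
    cutSize (p.multCut c) ≤ 2 * ∑ d ∈ (c.1.zip c.2).toFinset, cutSize d := by
  obtain ⟨hlen, hne, -⟩ := h.hF c hc
  rw [List.sum_toFinset _ (h.nodup_zip hp hc), sum_map_zip_cutSize hlen, cutSize_multCut]
  have h₁ := Tree.length_le_sum_size c.1
  have h₂ := Tree.length_le_sum_size c.2
  have h₃ := List.length_pos_of_ne_nil hne
  omega

theorem size_le (hp : p.IsMLL) (h : ParStepF p q F [] []) : p.size ≤ 2 * q.size := by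
  have hsplit := Finset.sum_inter_add_sum_sdiff p.cuts (melim F) cutSize
  have helim : ∑ d ∈ p.cuts ∩ melim F, cutSize d ≤ 2 * ∑ d ∈ mres F, cutSize d := calc
    _ ≤ ∑ d ∈ F.image p.multCut, cutSize d :=
      Finset.sum_le_sum_of_subset (h.inter_melim_subset hp)
    _ = ∑ c ∈ F, cutSize (p.multCut c) := Finset.sum_image p.multCut_injective.injOn
    _ ≤ ∑ c ∈ F, 2 * ∑ d ∈ (c.1.zip c.2).toFinset, cutSize d :=
      Finset.sum_le_sum fun c hc => h.cutSize_multCut_le hp hc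
    _ = 2 * ∑ d ∈ mres F, cutSize d := by
      rw [← Finset.mul_sum, mres, Finset.sum_biUnion (h.pairwiseDisjoint_zip hp)]
  have hq : ∑ d ∈ q.cuts, cutSize d
      = ∑ d ∈ p.cuts \ melim F, cutSize d + ∑ d ∈ mres F, cutSize d := by
    rw [h.cuts_eq, Finset.sum_union (h.disjoint_mres hp)]
  change ∑ d ∈ p.cuts, cutSize d + _ ≤ 2 * (∑ d ∈ q.cuts, cutSize d + _)
  rw [h.concl_eq]
  omega

end ParStepF

end MLLNets

namespace MLLNets

/-- If `p` and `q` are acyclic MLL proof nets and `p ⇒m q`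
    (parallel elimination of a family of multiplicative cuts), then
    `size(p) ≤ 2·size(q)`. -/
theorem mult_size_bound (p q : Net)
    (hp : p.IsMLL) (hq : q.IsMLL) (hpa : p.IsAcyclic) (hqa : q.IsAcyclic)
    (h : MultStep p q) :
    p.size ≤ 2 * q.size := by
  obtain ⟨F, hF⟩ := h
  exact hF.size_le hp

end MLLNets
end

section
/- If p and q are acyclic MLL proof nets and p ⇒e q (parallel elimination of a family of evanescent cuts), then size(p) ≤ size(q)·(1 + 2·(2·jd(p))^{ln(p)+1}). -/
/- Formalization of untyped MLL proof nets with jumps, switching paths,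
   and parallel cut elimination, following Chouquet & Vaux Auclair. -/

namespace MLLNets

attribute [local instance] Classical.propDecidable

end MLLNets

namespace MLLNets

section

attribute [local instance] Classical.propDecidable

theorem Tree.mem_ST_self_s3 (t : Tree) : t ∈ t.ST := by
  cases t <;> simp [Tree.ST]

theorem mem_foldr_union {α : Type*} (l : List (Finset α)) (x : α) :
    x ∈ l.foldr (· ∪ ·) ∅ ↔ ∃ s ∈ l, x ∈ s := by
  induction l with
  | nil => simp
  | cons a l ih => simp [ih]

theorem Tree.mem_ST_tens {x : Tree} {ts : List Tree} :
    x ∈ (Tree.tens ts).ST ↔ x = Tree.tens ts ∨ ∃ t ∈ ts, x ∈ t.ST := by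
  rw [Tree.ST, Finset.mem_insert, mem_foldr_union]
  simp

theorem Tree.mem_ST_parr {x : Tree} {ts : List Tree} :
    x ∈ (Tree.parr ts).ST ↔ x = Tree.parr ts ∨ ∃ t ∈ ts, x ∈ t.ST := by
  rw [Tree.ST, Finset.mem_insert, mem_foldr_union]
  simp

/-- The subtree relation is transitive. -/
theorem Tree.ST_subset {s t : Tree} (h : t ∈ s.ST) : t.ST ⊆ s.ST := by
  match s with
  | .var n b => simp only [Tree.ST, Finset.mem_singleton] at h; subst h; rfl
  | .unit l => simp only [Tree.ST, Finset.mem_singleton] at h; subst h; rfl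
  | .counit l => simp only [Tree.ST, Finset.mem_singleton] at h; subst h; rfl
  | .tens ts =>
    rcases Tree.mem_ST_tens.1 h with rfl | ⟨u, hu, hx⟩
    · rfl
    · exact fun y hy => Tree.mem_ST_tens.2 (Or.inr ⟨u, hu, Tree.ST_subset hx hy⟩)
  | .parr ts =>
    rcases Tree.mem_ST_parr.1 h with rfl | ⟨u, hu, hx⟩
    · rfl
    · exact fun y hy => Tree.mem_ST_parr.2 (Or.inr ⟨u, hu, Tree.ST_subset hx hy⟩)
termination_by sizeOf s
decreasing_by all_goals (have h := List.sizeOf_lt_of_mem hu; simp; omega)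

theorem card_foldr_union_le {α : Type*} (l : List (Finset α)) :
    (l.foldr (· ∪ ·) ∅).card ≤ (l.map Finset.card).sum := by
  induction l with
  | nil => simp
  | cons a l ih =>
    simp only [List.foldr_cons, List.map_cons, List.sum_cons]
    exact (Finset.card_union_le _ _).trans (by omega)

theorem Tree.card_ST_le_size (t : Tree) : t.ST.card ≤ t.size := by
  match t with
  | .var n b => simp [Tree.ST, Tree.size]
  | .unit l => simp [Tree.ST, Tree.size]
  | .counit l => simp [Tree.ST, Tree.size]
  | .tens ts =>
    rw [Tree.ST, Tree.size, add_comm]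
    refine (Finset.card_insert_le _ _).trans (Nat.add_le_add_right ?_ 1)
    refine (card_foldr_union_le _).trans ?_
    rw [List.map_map]
    refine List.sum_le_sum fun x _ => ?_
    exact Tree.card_ST_le_size x.1
  | .parr ts =>
    rw [Tree.ST, Tree.size, add_comm]
    refine (Finset.card_insert_le _ _).trans (Nat.add_le_add_right ?_ 1)
    refine (card_foldr_union_le _).trans ?_
    rw [List.map_map]
    refine List.sum_le_sum fun x _ => ?_
    exact Tree.card_ST_le_size x.1
termination_by sizeOf t
decreasing_by all_goals (have h := List.sizeOf_lt_of_mem x.2; simp; omega)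

namespace Net

theorem mem_ST {p : Net} {t : Tree} :
    t ∈ p.ST ↔ (∃ c ∈ p.cuts, t ∈ c.1.ST ∨ t ∈ c.2.ST) ∨ ∃ s ∈ p.concl, t ∈ s.ST := by
  rw [Net.ST, Finset.mem_union, mem_foldr_union]
  simp

theorem ST_closed {p : Net} {s t : Tree} (hs : s ∈ p.ST) (ht : t ∈ s.ST) : t ∈ p.ST := by
  rw [mem_ST] at hs ⊢
  rcases hs with ⟨c, hc, h | h⟩ | ⟨u, hu, h⟩
  · exact Or.inl ⟨c, hc, Or.inl (Tree.ST_subset h ht)⟩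
  · exact Or.inl ⟨c, hc, Or.inr (Tree.ST_subset h ht)⟩
  · exact Or.inr ⟨u, hu, Tree.ST_subset h ht⟩

theorem fst_mem_ST {p : Net} {s t : Tree} (h : (s, t) ∈ p.cuts) : s ∈ p.ST :=
  mem_ST.2 (Or.inl ⟨_, h, Or.inl s.mem_ST_self_s3⟩)

theorem snd_mem_ST {p : Net} {s t : Tree} (h : (s, t) ∈ p.cuts) : t ∈ p.ST :=
  mem_ST.2 (Or.inl ⟨_, h, Or.inr t.mem_ST_self_s3⟩)

theorem card_ST_le_size (p : Net) : p.ST.card ≤ p.size := by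
  refine (Finset.card_union_le _ _).trans (Nat.add_le_add ?_ ?_)
  · refine Finset.card_biUnion_le.trans (Finset.sum_le_sum fun c _ => ?_)
    exact (Finset.card_union_le _ _).trans
      (Nat.add_le_add c.1.card_ST_le_size c.2.card_ST_le_size)
  · refine (card_foldr_union_le _).trans ?_
    rw [List.map_map]
    exact List.sum_le_sum fun t _ => t.card_ST_le_size

theorem mem_counitLabels {p : Net} {m : ℕ} : m ∈ p.counitLabels ↔ Tree.counit m ∈ p.ST := by
  rw [counitLabels, Finset.mem_biUnion]
  constructor
  · rintro ⟨t, ht, hm⟩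
    split at hm
    · rw [Finset.mem_singleton] at hm
      exact hm ▸ ht
    · simp at hm
  · exact fun h => ⟨_, h, by simp⟩

theorem card_jump_le_jd {p : Net} (hp : p.IsMLL) (t : Tree) :
    (p.counitLabels.filter fun m => p.jump m = t).card ≤ p.jd := by
  by_cases ht : t ∈ p.ST
  · exact Finset.le_sup (f := fun t => (p.counitLabels.filter fun m => p.jump m = t).card) ht
  · rw [Finset.filter_eq_empty_iff.2, Finset.card_empty]
    · exact Nat.zero_le _
    · rintro m hm rfl
      exact ht (hp.2.2.2.2 m (mem_counitLabels.1 hm))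

theorem cut_unique {p : Net} (hp : p.IsMLL) {a : Atom} {c c' : Tree × Tree}
    (hc : c ∈ p.cuts) (hc' : c' ∈ p.cuts) (ha : a ∈ c.1.atoms + c.2.atoms)
    (ha' : a ∈ c'.1.atoms + c'.2.atoms) : c = c' := by
  by_contra hne
  have hn : (p.cuts.sum fun c => c.1.atoms + c.2.atoms).Nodup :=
    (Multiset.nodup_add.1 hp.1).1
  rw [← Finset.add_sum_erase _ _ hc, Multiset.nodup_add] at hn
  refine Multiset.disjoint_left.1 hn.2.2 ha ?_
  rw [Multiset.mem_sum]
  exact ⟨c', Finset.mem_erase.2 ⟨Ne.symm hne, hc'⟩, ha'⟩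

theorem IsEvCut.unit_unique {p : Net} (hp : p.IsMLL) {l l' m : ℕ} (h : p.IsEvCut l m)
    (h' : p.IsEvCut l' m) : l = l' := by
  rcases h.1 with h | h <;> rcases h'.1 with h' | h' <;>
  · have := cut_unique hp (a := Atom.counit m) h h' (by simp [Tree.atoms]) (by simp [Tree.atoms])
    simp_all

theorem card_Iset_le {p : Net} (hp : p.IsMLL) (t : Tree) (n : ℕ) :
    (p.Iset t n).card ≤ p.jd * (2 * p.jd) ^ n := by
  induction n with
  | zero => simpa [Iset] using card_jump_le_jd hp t
  | succ n ih =>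
    have hsub : p.Iset t (n + 1) ⊆ (p.Iset t n).biUnion fun m =>
        (p.counitLabels.filter fun m' => p.jump m' = Tree.counit m) ∪
        (p.counitLabels.filter fun m' => ∃ l, p.IsEvCut l m ∧ p.jump m' = Tree.unit l) := by
      intro m' hm'
      simp only [Iset, Finset.mem_filter] at hm'
      obtain ⟨hm', l, m, hlm, hm, hj⟩ := hm'
      simp only [Finset.mem_biUnion, Finset.mem_union, Finset.mem_filter]
      exact ⟨m, hm, hj.imp (⟨hm', ·⟩) (⟨hm', l, hlm, ·⟩)⟩
    refine (Finset.card_le_card hsub).trans ?_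
    refine (Finset.card_biUnion_le_card_mul _ _ (2 * p.jd) fun m _ => ?_).trans ?_
    · refine (Finset.card_union_le _ _).trans ?_
      rw [two_mul]
      refine Nat.add_le_add (card_jump_le_jd hp _) ?_
      by_cases hl : ∃ l, p.IsEvCut l m
      · obtain ⟨l, hl⟩ := hl
        refine (Finset.card_le_card ?_).trans (card_jump_le_jd hp (Tree.unit l))
        intro m' hm'
        simp only [Finset.mem_filter] at hm' ⊢
        obtain ⟨hm', l', hl', hj⟩ := hm'
        exact ⟨hm', hl.unit_unique hp hl' ▸ hj⟩
      · rw [Finset.filter_eq_empty_iff.2, Finset.card_empty]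
        · exact Nat.zero_le _
        · rintro m' - ⟨l, h, -⟩
          exact hl ⟨l, h⟩
    · rw [pow_succ, ← mul_assoc p.jd]
      exact Nat.mul_le_mul_right _ ih

theorem exists_isSwitching {p : Net} (hp : p.IsMLL) : ∃ I, p.IsSwitching I := by
  refine ⟨fun t => match t with | Tree.parr ts => ts.headI | _ => default, fun ts hts => ?_⟩
  have h := hp.2.2.1 ts hts
  cases ts with
  | nil => exact absurd rfl h
  | cons a l => simp

theorem Adj.mem_ST {p : Net} (hp : p.IsMLL) {I : Tree → Tree} (hI : p.IsSwitching I)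
    {e : Edge} {t u : Tree} (h : p.Adj I e t u) : t ∈ p.ST ∧ u ∈ p.ST := by
  induction h with
  | ax n h h' => exact ⟨h, h'⟩
  | tens h h' =>
    exact ⟨h, ST_closed h (Tree.mem_ST_tens.2 (Or.inr ⟨_, h', Tree.mem_ST_self_s3 _⟩))⟩
  | parr h =>
    exact ⟨h, ST_closed h (Tree.mem_ST_parr.2 (Or.inr ⟨_, hI _ h, Tree.mem_ST_self_s3 _⟩))⟩
  | jump h => exact ⟨h, hp.2.2.2.2 _ h⟩
  | cut h => exact ⟨fst_mem_ST h, snd_mem_ST h⟩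
  | symm _ ih => exact ih.symm

theorem IsTrail.subset_ST {p : Net} (hp : p.IsMLL) {I : Tree → Tree} (hI : p.IsSwitching I)
    {t : Tree} {l : List (Edge × Tree)} (h : p.IsTrail I t l) :
    ∀ x ∈ t :: l.map Prod.snd, x ∈ p.ST := by
  induction h with
  | nil t ht => simpa using ht
  | cons ha _ _ ih =>
    intro x hx
    rcases List.mem_cons.1 hx with rfl | hx
    · exact (ha.mem_ST hp hI).1
    · exact ih x (by simpa using hx)

theorem IsTrail.length_le_ln {p : Net} (hp : p.IsMLL) (hpa : p.IsAcyclic) {I : Tree → Tree}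
    (hI : p.IsSwitching I) {t : Tree} {l : List (Edge × Tree)} (h : p.IsTrail I t l) :
    l.length ≤ p.ln := by
  refine le_csSup ⟨p.ST.card, ?_⟩ ⟨I, t, l, hI, h, rfl⟩
  rintro n ⟨I, t, l, hI, h, rfl⟩
  have hsub : (t :: l.map Prod.snd).toFinset ⊆ p.ST := fun x hx =>
    h.subset_ST hp hI x (List.mem_toFinset.1 hx)
  have hc := Finset.card_le_card hsub
  rw [List.toFinset_card_of_nodup (hpa I hI t l h)] at hc
  simp at hc
  omega

end Net

theorem mem_eelim {le : List (ℕ × ℕ)} {c : Tree × Tree} :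
    c ∈ eelim le ↔ ∃ e ∈ le, c = (Tree.unit e.1, Tree.counit e.2) ∨
      c = (Tree.counit e.2, Tree.unit e.1) := by
  induction le with
  | nil => simp [eelim]
  | cons a le ih =>
    rw [show eelim (a :: le) = insert (Tree.unit a.1, Tree.counit a.2)
      (insert (Tree.counit a.2, Tree.unit a.1) (eelim le)) from rfl]
    simp [ih, or_assoc]

namespace ParStepF

variable {p q : Net} {le : List (ℕ × ℕ)}

theorem cuts_eq_of_ev (h : ParStepF p q ∅ [] le) : q.cuts = p.cuts \ eelim le := by
  rw [h.hcuts]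
  simp [melim, mres, aelim, Tree.substList]

theorem concl_eq_of_ev (h : ParStepF p q ∅ [] le) : q.concl = p.concl := by
  rw [h.hconcl]
  exact List.map_id _

theorem mem_ST_of_ev (h : ParStepF p q ∅ [] le) {t : Tree} (ht : t ∈ p.ST)
    (hle : ∀ e ∈ le, t ≠ Tree.counit e.2 ∧ t ≠ Tree.unit e.1) : t ∈ q.ST := by
  rw [Net.mem_ST] at ht ⊢
  rw [h.cuts_eq_of_ev, h.concl_eq_of_ev]
  refine ht.imp_left ?_
  rintro ⟨c, hc, hct⟩
  refine ⟨c, Finset.mem_sdiff.2 ⟨hc, fun hce => ?_⟩, hct⟩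
  obtain ⟨e, he, rfl | rfl⟩ := mem_eelim.1 hce <;>
  · have := hle e he
    simp [Tree.ST] at hct
    tauto

theorem isEvCut (h : ParStepF p q ∅ [] le) {j : ℕ} (hj : j < le.length) :
    p.IsEvCut le[j].1 le[j].2 := by
  have := h.heJ j j le_rfl hj
  rw [List.getD_eq_getElem _ _ hj] at this
  exact ⟨h.he _ (List.getElem_mem hj), this.2, this.1⟩

theorem counit_mem_ST (h : ParStepF p q ∅ [] le) {j : ℕ} (hj : j < le.length) :
    Tree.counit le[j].2 ∈ p.ST := by
  rcases h.he _ (List.getElem_mem hj) with h | h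
  · exact Net.snd_mem_ST h
  · exact Net.fst_mem_ST h

theorem label_inj (h : ParStepF p q ∅ [] le) {i j : ℕ} (hi : i < le.length) (hj : j < le.length)
    (hij : le[i].2 = le[j].2) : i = j := by
  have := h.heN
  refine (List.Nodup.getElem_inj_iff this (hi := by simpa) (hj := by simpa)).1 ?_
  simpa using hij

/-- Following the jumps from an eliminated counit through eliminated cuts reaches a subtree of
the reduct, along a switching path with one jump edge for each eliminated cut. -/
theorem exists_chain (h : ParStepF p q ∅ [] le) (hp : p.IsMLL) (I : Tree → Tree) (j : ℕ)
    (hj : j < le.length) :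
    ∃ t ∈ q.ST, ∃ n, le[j].2 ∈ p.Iset t n ∧ ∃ l, p.IsTrail I (Tree.counit le[j].2) l ∧
      n + 1 ≤ l.length ∧ ∀ x ∈ l, ∃ (i : ℕ) (hi : i < le.length),
        (i ≤ j ∧ x.1 = Edge.jumpE le[i].2) ∨
        (i < j ∧ (x.1 = Edge.cutE (Tree.unit le[i].1) (Tree.counit le[i].2) ∨
          x.1 = Edge.cutE (Tree.counit le[i].2) (Tree.unit le[i].1))) := by
  induction j using Nat.strong_induction_on with
  | _ j ih =>
  have hST := h.counit_mem_ST hj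
  have hlab := Net.mem_counitLabels.2 hST
  have hadj : p.Adj I (Edge.jumpE le[j].2) (Tree.counit le[j].2) (p.jump le[j].2) :=
    Net.Adj.jump hST
  by_cases hc : ∃ (i : ℕ) (hi : i < le.length),
      p.jump le[j].2 = Tree.counit le[i].2 ∨ p.jump le[j].2 = Tree.unit le[i].1
  · obtain ⟨i, hi, hjump⟩ := hc
    have hij : i < j := by
      by_contra hle
      have := h.heJ j i (not_lt.1 hle) hi
      rw [List.getD_eq_getElem _ _ hj, List.getD_eq_getElem _ _ hi] at this
      tauto
    obtain ⟨t, ht, n, hn, l, hl, hlen, hedge⟩ := ih i hij hi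
    refine ⟨t, ht, n + 1, ?_, ?_⟩
    · exact Finset.mem_filter.2 ⟨hlab, _, _, h.isEvCut hi, hn, hjump⟩
    · have hfresh : ∀ x ∈ l, x.1 ≠ Edge.jumpE le[j].2 := by
        intro x hx hxe
        obtain ⟨k, hk, ⟨hki, hx⟩ | ⟨hki, hx | hx⟩⟩ := hedge x hx
        · rw [hxe, Edge.jumpE.injEq] at hx
          have := h.label_inj hj hk hx
          omega
        · simp [hxe] at hx
        · simp [hxe] at hx
      have hedge' : ∀ x ∈ l, ∃ (k : ℕ) (hk : k < le.length),
          (k ≤ j ∧ x.1 = Edge.jumpE le[k].2) ∨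
          (k < j ∧ (x.1 = Edge.cutE (Tree.unit le[k].1) (Tree.counit le[k].2) ∨
            x.1 = Edge.cutE (Tree.counit le[k].2) (Tree.unit le[k].1))) := by
        intro x hx
        obtain ⟨k, hk, hx⟩ := hedge x hx
        exact ⟨k, hk, hx.imp (And.imp_left fun h => by omega) (And.imp_left fun h => by omega)⟩
      rcases hjump with hjump | hjump
      · rw [hjump] at hadj
        refine ⟨_ :: l, Net.IsTrail.cons hadj hl hfresh, by simp; omega, ?_⟩
        intro x hx
        rcases List.mem_cons.1 hx with rfl | hx
        · exact ⟨j, hj, Or.inl ⟨le_rfl, rfl⟩⟩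
        · exact hedge' x hx
      · rw [hjump] at hadj
        obtain ⟨e, he, hcut⟩ : ∃ e, (e = Edge.cutE (Tree.unit le[i].1) (Tree.counit le[i].2) ∨
            e = Edge.cutE (Tree.counit le[i].2) (Tree.unit le[i].1)) ∧
            p.Adj I e (Tree.unit le[i].1) (Tree.counit le[i].2) := by
          rcases h.he _ (List.getElem_mem hi) with hcut | hcut
          · exact ⟨_, Or.inl rfl, Net.Adj.cut hcut⟩
          · exact ⟨_, Or.inr rfl, Net.Adj.symm (Net.Adj.cut hcut)⟩
        have hl' : p.IsTrail I (Tree.unit le[i].1) ((e, Tree.counit le[i].2) :: l) := by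
          refine Net.IsTrail.cons hcut hl ?_
          intro x hx hxe
          obtain ⟨k, hk, ⟨hki, hx⟩ | ⟨hki, hx⟩⟩ := hedge x hx
          · rcases he with he | he <;> simp [hxe, he] at hx
          · have : le[k].2 = le[i].2 := by
              rcases he with he | he <;> rcases hx with hx | hx <;>
                simp [hxe, he] at hx <;> simp [hx]
            have := h.label_inj hk hi this
            omega
        refine ⟨_ :: _ :: l, Net.IsTrail.cons hadj hl' ?_, by simp; omega, ?_⟩
        · intro x hx
          rcases List.mem_cons.1 hx with rfl | hx
          · rcases he with he | he <;> simp [he]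
          · exact hfresh x hx
        · intro x hx
          rcases List.mem_cons.1 hx with rfl | hx
          · exact ⟨j, hj, Or.inl ⟨le_rfl, rfl⟩⟩
          rcases List.mem_cons.1 hx with rfl | hx
          · exact ⟨i, hi, Or.inr ⟨hij, he⟩⟩
          · exact hedge' x hx
  · have hjST := hp.2.2.2.2 _ hST
    refine ⟨p.jump le[j].2, h.mem_ST_of_ev hjST ?_, 0, ?_, ?_⟩
    · intro e he
      obtain ⟨i, hi, rfl⟩ := List.getElem_of_mem he
      exact ⟨fun h => hc ⟨i, hi, Or.inl h⟩, fun h => hc ⟨i, hi, Or.inr h⟩⟩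
    · exact Finset.mem_filter.2 ⟨hlab, rfl⟩
    · refine ⟨[_], Net.IsTrail.cons hadj (Net.IsTrail.nil _ hjST) (by simp), by simp, ?_⟩
      intro x hx
      rw [List.mem_singleton.1 hx]
      exact ⟨j, hj, Or.inl ⟨le_rfl, rfl⟩⟩

theorem card_inter_eelim_le (hp : p.IsMLL) :
    (p.cuts ∩ eelim le).card ≤ (le.map Prod.snd).toFinset.card := by
  have hex : ∀ c ∈ p.cuts ∩ eelim le, ∃ m ∈ (le.map Prod.snd).toFinset,
      Atom.counit m ∈ c.1.atoms + c.2.atoms := by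
    intro c hc
    obtain ⟨e, he, hc⟩ := mem_eelim.1 (Finset.mem_inter.1 hc).2
    refine ⟨e.2, by simpa using ⟨_, he⟩, ?_⟩
    rcases hc with rfl | rfl <;> simp [Tree.atoms]
  choose! f hf hfa using hex
  refine Finset.card_le_card_of_injOn f hf fun c hc c' hc' heq => ?_
  exact Net.cut_unique hp (Finset.mem_inter.1 hc).1 (Finset.mem_inter.1 hc').1 (hfa c hc)
    (heq ▸ hfa c' hc')

theorem size_le_of_ev (h : ParStepF p q ∅ [] le) (hp : p.IsMLL) :
    p.size ≤ q.size + 2 * (le.map Prod.snd).toFinset.card := by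
  have hsum : ((p.cuts ∩ eelim le).sum fun c => c.1.size + c.2.size) =
      (p.cuts ∩ eelim le).card * 2 := by
    refine Finset.sum_const_nat fun c hc => ?_
    obtain ⟨e, -, rfl | rfl⟩ := mem_eelim.1 (Finset.mem_inter.1 hc).2 <;> simp [Tree.size]
  have hsplit := Finset.sum_inter_add_sum_sdiff p.cuts (eelim le)
    (fun c : Tree × Tree => c.1.size + c.2.size)
  have hcard := card_inter_eelim_le (le := le) hp
  rw [Net.size, Net.size, h.cuts_eq_of_ev, h.concl_eq_of_ev]
  omega

end ParStepF

end

theorem sum_mul_two_mul_pow_le (d n : ℕ) :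
    ∑ i ∈ Finset.range n, d * (2 * d) ^ i ≤ (2 * d) ^ (n + 1) := by
  induction n with
  | zero => simp
  | succ n ih =>
    rw [Finset.sum_range_succ]
    rcases Nat.eq_zero_or_pos d with rfl | hd
    · simp
    · calc _ ≤ (2 * d) ^ (n + 1) + (2 * d) * (2 * d) ^ n :=
            Nat.add_le_add ih (Nat.mul_le_mul_right _ (by omega))
        _ = 2 * (2 * d) ^ (n + 1) := by ring
        _ ≤ (2 * d) * (2 * d) ^ (n + 1) := Nat.mul_le_mul_right _ (by omega)
        _ = _ := by ring

/-- If `p` and `q` are acyclic MLL proof nets and `p ⇒e q`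
    (parallel elimination of a family of evanescent cuts), then
    `size(p) ≤ size(q)·(1 + 2·(2·jd(p))^(ln(p)+1))`. -/
theorem ev_size_bound (p q : Net)
    (hp : p.IsMLL) (hq : q.IsMLL) (hpa : p.IsAcyclic) (hqa : q.IsAcyclic)
    (h : EvStep p q) :
    p.size ≤ q.size * (1 + 2 * (2 * p.jd) ^ (p.ln + 1)) := by

  obtain ⟨le, h⟩ := h
  obtain ⟨I, hI⟩ := Net.exists_isSwitching hp
  have hsub : (le.map Prod.snd).toFinset ⊆
      q.ST.biUnion fun t => (Finset.range p.ln).biUnion fun n => p.Iset t n := by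
    intro m hm
    obtain ⟨e, he, rfl⟩ := List.mem_map.1 (List.mem_toFinset.1 hm)
    obtain ⟨j, hj, rfl⟩ := List.getElem_of_mem he
    obtain ⟨t, ht, n, hn, l, hl, hlen, -⟩ := h.exists_chain hp I j hj
    simp only [Finset.mem_biUnion, Finset.mem_range]
    exact ⟨t, ht, n, hlen.trans (hl.length_le_ln hp hpa hI), hn⟩
  have hcard : (le.map Prod.snd).toFinset.card ≤ q.size * (2 * p.jd) ^ (p.ln + 1) := by
    refine (Finset.card_le_card hsub).trans ?_
    refine (Finset.card_biUnion_le_card_mul _ _ _ fun t _ => ?_).trans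
      (Nat.mul_le_mul_right _ q.card_ST_le_size)
    refine Finset.card_biUnion_le.trans ?_
    exact (Finset.sum_le_sum fun n _ => Net.card_Iset_le hp t n).trans
      (sum_mul_two_mul_pow_le _ _)
  have hsize := h.size_le_of_ev hp
  rw [mul_add, mul_one, mul_left_comm]
  omega

end MLLNets
end
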